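/- Chattering lemma: let (U,d) be a compact separable metric space and let (μ_t)_{t ∈ [0,T]} be a measurable family of probability measures on U. Then there exists a sequence (u^n_t)_n of measurable U-valued functions such that the measures δ_{u^n_t}(da) dt converge stably (hence weakly) to μ_t(da) dt on [0,T] × U. -/

import Mathlib

open MeasureTheory Filter Topology

/-- A family of probability measures on a metric space that is Borel measurable for the weak
topology is measurable as a family of measures. -/
lemma measurable_toMeasure_of_measurable_borel {X U : Type*} [MeasurableSpace X]
    [PseudoMetricSpace U] [MeasurableSpace U] [BorelSpace U] {μ : X → ProbabilityMeasure U}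
    (hμ : @Measurable X (ProbabilityMeasure U) inferInstance (borel (ProbabilityMeasure U)) μ) :
    Measurable fun x => (μ x : Measure U) := by
  let : MeasurableSpace (ProbabilityMeasure U) := borel _
  have : BorelSpace (ProbabilityMeasure U) := ⟨rfl⟩
  refine Measurable.measure_of_isPiSystem_of_isProbabilityMeasure
    (BorelSpace.measurable_eq.trans borel_eq_generateFrom_isClosed) isPiSystem_isClosed ?_
  intro F hF
  obtain ⟨δ, -, hδ, hδ'⟩ := exists_seq_strictAnti_tendsto (0 : ℝ)
  refine measurable_of_tendsto_metrizable (fun n => ?_)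
    (tendsto_pi_nhds.2 fun x =>
      tendsto_lintegral_thickenedIndicator_of_isClosed (μ x : Measure U) hF hδ hδ')
  exact (ProbabilityMeasure.continuous_lintegral_boundedContinuousFunction
    (thickenedIndicator (hδ n) F)).measurable.comp hμ

/-- A function into `C(U, ℝ)`, with `U` compact metric, is strongly measurable if it is measurable
at every point of `U`. -/
lemma stronglyMeasurable_continuousMap_of_eval {X U : Type*} [MeasurableSpace X]
    [MetricSpace U] [CompactSpace U] [Nonempty U] {Φ : X → C(U, ℝ)}
    (hΦ : ∀ a, Measurable fun x => Φ x a) : StronglyMeasurable Φ := by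
  let : MeasurableSpace C(U, ℝ) := borel _
  have : BorelSpace C(U, ℝ) := ⟨rfl⟩
  have hemb : MeasurableEmbedding
      (fun (f : C(U, ℝ)) (n : ℕ) => f (TopologicalSpace.denseSeq U n)) := by
    refine Continuous.measurableEmbedding (by fun_prop) fun f g hfg => ?_
    refine DFunLike.coe_injective (f.continuous.ext_on
      (TopologicalSpace.denseRange_denseSeq U) g.continuous ?_)
    rintro _ ⟨n, rfl⟩
    exact congrFun hfg n
  refine Measurable.stronglyMeasurable (hemb.measurable_comp_iff.1 ?_)
  exact measurable_pi_lambda _ fun n => hΦ _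

/-- Any probability measure on a standard Borel space is the law of a measurable function on an
interval equipped with normalized Lebesgue measure. -/
lemma exists_measurable_intervalIntegral_eq {U : Type*} [Nonempty U] [MeasurableSpace U]
    [StandardBorelSpace U] (ν : Measure U) [IsProbabilityMeasure ν] {a b : ℝ} (hab : a < b) :
    ∃ g : ℝ → U, Measurable g ∧ ∀ f : U → ℝ, Measurable f →
      ∫ t in a..b, f (g t) = (b - a) * ∫ x, f x ∂ν := by
  obtain ⟨F, hF, hFν⟩ := ν.exists_measurable_map_eq
  have hba : b - a ≠ 0 := (sub_pos.2 hab).ne'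
  let G : ℝ → U := fun s => F (Set.projIcc 0 1 zero_le_one s)
  have hG : Measurable G := hF.comp continuous_projIcc.measurable
  refine ⟨fun t => G (t / (b - a) - a / (b - a)), hG.comp (by fun_prop), fun f hf => ?_⟩
  rw [intervalIntegral.integral_comp_div_sub (fun s => f (G s)) hba, smul_eq_mul, ← hFν,
    integral_map hF.aemeasurable hf.aestronglyMeasurable]
  congr 1
  rw [sub_self, ← sub_div, div_self hba, intervalIntegral.integral_of_le zero_le_one,
    ← integral_Icc_eq_integral_Ioc, ← integral_subtype_comap measurableSet_Icc]
  exact integral_congr_ae (ae_of_all _ fun x => by simp [G])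

open ProbabilityTheory in
/-- On an interval, a measurable family of probability measures has the same time-averaged
integrals as some measurable function. -/
lemma exists_measurable_intervalIntegral_eq_kernel {U : Type*} [Nonempty U] [MeasurableSpace U]
    [StandardBorelSpace U] (κ : Kernel ℝ U) [IsMarkovKernel κ] {a b : ℝ} (hab : a < b) :
    ∃ g : ℝ → U, Measurable g ∧ ∀ f : U → ℝ, Measurable f → (∃ C, ∀ x, |f x| ≤ C) →
      ∫ t in a..b, f (g t) = ∫ t in a..b, ∫ x, f x ∂(κ t) := by
  have hvol : volume (Set.Ioc a b) ≠ 0 := by simp [hab]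
  have : IsProbabilityMeasure (volume[|Set.Ioc a b]) := cond_isProbabilityMeasure_of_finite hvol
    (by simp)
  let ν : Measure U := (volume[|Set.Ioc a b] ⊗ₘ κ).map Prod.snd
  have : IsProbabilityMeasure ν := Measure.isProbabilityMeasure_map (by fun_prop)
  obtain ⟨g, hg, hgν⟩ := exists_measurable_intervalIntegral_eq ν hab
  refine ⟨g, hg, fun f hf ⟨C, hC⟩ => ?_⟩
  rw [hgν f hf, integral_map (by fun_prop) hf.aestronglyMeasurable, Measure.integral_compProd]
  · rw [ProbabilityTheory.cond, integral_smul_measure, intervalIntegral.integral_of_le hab.le, Real.volume_Ioc,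
      ENNReal.toReal_inv, ENNReal.toReal_ofReal (sub_pos.2 hab).le, smul_eq_mul,
      mul_inv_cancel_left₀ (sub_pos.2 hab).ne']
  · exact .of_bound (hf.comp measurable_snd).aestronglyMeasurable C (ae_of_all _ fun x => hC _)

open ProbabilityTheory in
/-- On the `N` consecutive intervals of length `h` starting at `0`, one measurable function has the
same averaged integrals as a given measurable family of probability measures. -/
lemma exists_measurable_intervalIntegral_grid_eq {U : Type*} [Nonempty U] [MeasurableSpace U]
    [StandardBorelSpace U] (κ : Kernel ℝ U) [IsMarkovKernel κ] {h : ℝ} (hh : 0 < h) :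
    ∃ u : ℝ → U, Measurable u ∧ ∀ f : U → ℝ, Measurable f → (∃ C, ∀ x, |f x| ≤ C) → ∀ k : ℕ,
      ∫ t in k * h..(k + 1 : ℕ) * h, f (u t) =
        ∫ t in k * h..(k + 1 : ℕ) * h, ∫ x, f x ∂(κ t) := by
  have hlt (k : ℕ) : k * h < (k + 1 : ℕ) * h := by push_cast; linarith
  choose g hg hgf using fun k : ℕ => exists_measurable_intervalIntegral_eq_kernel κ (hlt k)
  refine ⟨fun t => g (⌈t / h⌉₊ - 1) t, ?_, fun f hf hC k => ?_⟩
  · have : Measurable fun p : ℕ × ℝ => g p.1 p.2 := measurable_from_prod_countable_right hg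
    exact this.comp (f := fun t : ℝ => (⌈t / h⌉₊ - 1, t)) (by fun_prop)
  · rw [← hgf k f hf hC]
    refine intervalIntegral.integral_congr_ae (ae_of_all _ fun t ht => ?_)
    rw [Set.uIoc_of_le (hlt k).le] at ht
    have : ⌈t / h⌉₊ = k + 1 := by
      rw [Nat.ceil_eq_iff (by simp)]
      exact ⟨by simpa [lt_div_iff₀ hh] using ht.1, by rw [div_le_iff₀ hh]; exact ht.2⟩
    simp [this]

section Deviation

variable {U : Type*} [MetricSpace U] [CompactSpace U] [MeasurableSpace U]

/-- The error made when evaluating `f` at `x` instead of integrating it against `ν`. -/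
noncomputable def integralDeviation (ν : Measure U) (x : U) (f : C(U, ℝ)) : ℝ :=
  f x - ∫ a, f a ∂ν

lemma norm_integralDeviation_le (ν : Measure U) [IsProbabilityMeasure ν] (x : U) (f : C(U, ℝ)) :
    ‖integralDeviation ν x f‖ ≤ 2 * ‖f‖ := by
  have h : ‖∫ a, f a ∂ν‖ ≤ ‖f‖ := by
    simpa using norm_integral_le_of_norm_le_const (μ := ν) (ae_of_all _ f.norm_coe_le_norm)
  calc _ ≤ ‖f x‖ + ‖∫ a, f a ∂ν‖ := norm_sub_le _ _
    _ ≤ 2 * ‖f‖ := by linarith [f.norm_coe_le_norm x]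

variable [BorelSpace U]

lemma integralDeviation_sub (ν : Measure U) [IsFiniteMeasure ν] (x : U) (f g : C(U, ℝ)) :
    integralDeviation ν x (f - g) = integralDeviation ν x f - integralDeviation ν x g := by
  have hi (f : C(U, ℝ)) : Integrable (fun a => f a) ν :=
    .of_bound f.continuous.measurable.aestronglyMeasurable ‖f‖
      (ae_of_all _ f.norm_coe_le_norm)
  simp only [integralDeviation, ContinuousMap.sub_apply, integral_sub (hi f) (hi g)]
  ring

open ProbabilityTheory

lemma stronglyMeasurable_integral_continuousMap {X : Type*} [MeasurableSpace X] (κ : Kernel X U)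
    [IsMarkovKernel κ] {Φ : X → C(U, ℝ)} (hΦ : StronglyMeasurable Φ) :
    StronglyMeasurable fun t => ∫ a, Φ t a ∂(κ t) := by
  refine StronglyMeasurable.integral_kernel_prod_right' (κ := κ) (f := fun p => Φ p.1 p.2) ?_
  have hev : Continuous fun q : C(U, ℝ) × U => q.1 q.2 := by fun_prop
  exact hev.comp_stronglyMeasurable
    ((hΦ.comp_measurable measurable_fst).prodMk measurable_snd.stronglyMeasurable)

lemma stronglyMeasurable_eval_continuousMap {X : Type*} [MeasurableSpace X] {Φ : X → C(U, ℝ)}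
    (hΦ : StronglyMeasurable Φ) {u : X → U} (hu : Measurable u) :
    StronglyMeasurable fun t => Φ t (u t) := by
  have hev : Continuous fun q : C(U, ℝ) × U => q.1 q.2 := by fun_prop
  exact hev.comp_stronglyMeasurable (hΦ.prodMk hu.stronglyMeasurable)

lemma integrable_integralDeviation {X : Type*} [MeasurableSpace X] {m : Measure X}
    (κ : Kernel X U) [IsMarkovKernel κ] {u : X → U} (hu : Measurable u) {Φ : X → C(U, ℝ)}
    (hΦ : StronglyMeasurable Φ) (hi : Integrable Φ m) :
    Integrable (fun t => integralDeviation (κ t) (u t) (Φ t)) m := by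
  refine Integrable.mono' (hi.norm.const_mul 2) ?_
    (ae_of_all _ fun t => norm_integralDeviation_le _ _ _)
  exact ((stronglyMeasurable_eval_continuousMap hΦ hu).sub
    (stronglyMeasurable_integral_continuousMap κ hΦ)).aestronglyMeasurable

/-- If the deviations of constant-in-time test functions integrate to zero over a cell, the
deviation of a test function that varies little over the cell is small. -/
lemma norm_integral_integralDeviation_cell_le (κ : Kernel ℝ U) [IsMarkovKernel κ] {u : ℝ → U}
    (hu : Measurable u) {a b : ℝ} (hab : a ≤ b) {Ψ : ℝ → C(U, ℝ)} (hΨ : Continuous Ψ)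
    (hzero : ∫ t in a..b, Ψ a (u t) = ∫ t in a..b, ∫ x, Ψ a x ∂(κ t))
    {ε : ℝ} (hε : ∀ t ∈ Set.Ioc a b, ‖Ψ t - Ψ a‖ ≤ ε) :
    ‖∫ t in a..b, integralDeviation (κ t) (u t) (Ψ t)‖ ≤ 2 * ε * (b - a) := by
  have hint {Θ : ℝ → C(U, ℝ)} (hΘ : Continuous Θ) :
      IntervalIntegrable (fun t => integralDeviation (κ t) (u t) (Θ t)) volume a b := by
    rw [intervalIntegrable_iff_integrableOn_Ioc_of_le hab]
    exact integrable_integralDeviation κ hu hΘ.stronglyMeasurable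
      (hΘ.integrableOn_Icc.mono_set Set.Ioc_subset_Icc_self)
  have hconst : ∫ t in a..b, integralDeviation (κ t) (u t) (Ψ a) = 0 := by
    have h1 : IntervalIntegrable (fun t => Ψ a (u t)) volume a b :=
      intervalIntegrable_const.mono_fun' (g := fun _ => ‖Ψ a‖)
        (stronglyMeasurable_eval_continuousMap stronglyMeasurable_const hu).aestronglyMeasurable
        (ae_of_all _ fun t => (Ψ a).norm_coe_le_norm _)
    have h2 : IntervalIntegrable (fun t => ∫ x, Ψ a x ∂(κ t)) volume a b :=
      intervalIntegrable_const.mono_fun' (g := fun _ => ‖Ψ a‖)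
        (stronglyMeasurable_integral_continuousMap κ stronglyMeasurable_const).aestronglyMeasurable
        (ae_of_all _ fun t => by
          simpa using norm_integral_le_of_norm_le_const (μ := κ t)
            (ae_of_all _ (Ψ a).norm_coe_le_norm))
    simp only [integralDeviation]
    rw [intervalIntegral.integral_sub h1 h2, hzero, sub_self]
  rw [← sub_zero (∫ t in a..b, _), ← hconst,
    ← intervalIntegral.integral_sub (hint hΨ) (hint continuous_const),
    ← abs_of_nonneg (sub_nonneg.2 hab)]
  refine intervalIntegral.norm_integral_le_of_norm_le_const fun t ht => ?_
  rw [Set.uIoc_of_le hab] at ht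
  rw [← integralDeviation_sub]
  exact (norm_integralDeviation_le _ _ _).trans (by linarith [hε t ht])

/-- Functions that match the time averages of `κ` on finer and finer grids of `[0, T]` have
asymptotically no deviation against uniformly continuous test functions. -/
lemma tendsto_integral_integralDeviation_of_uniformContinuous (κ : Kernel ℝ U) [IsMarkovKernel κ]
    {T : ℝ} (hT : 0 < T) {u : ℕ → ℝ → U} (hu : ∀ n, Measurable (u n))
    (huκ : ∀ (n : ℕ) (f : C(U, ℝ)) (k : ℕ),
      ∫ t in k * (T / (n + 1))..(k + 1 : ℕ) * (T / (n + 1)), f (u n t) =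
        ∫ t in k * (T / (n + 1))..(k + 1 : ℕ) * (T / (n + 1)), ∫ x, f x ∂(κ t))
    {Ψ : ℝ → C(U, ℝ)} (hΨ : UniformContinuous Ψ) :
    Tendsto (fun n => ∫ t in (0)..T, integralDeviation (κ t) (u n t) (Ψ t)) atTop (𝓝 0) := by
  rw [Metric.tendsto_atTop]
  intro ε hε
  have hη : 0 < ε / (4 * T) := by positivity
  obtain ⟨δ, hδ, hΨδ⟩ := Metric.uniformContinuous_iff.1 hΨ _ hη
  have hlim : Tendsto (fun n : ℕ => T / ((n : ℝ) + 1)) atTop (𝓝 0) :=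
    tendsto_const_nhds.div_atTop (tendsto_atTop_add_const_right _ _ tendsto_natCast_atTop_atTop)
  obtain ⟨N, hN⟩ := eventually_atTop.1 (hlim.eventually_lt_const hδ)
  refine ⟨N, fun n hn => ?_⟩
  have hn' := hN n hn
  set h : ℝ := T / ((n : ℝ) + 1) with hh
  have hpos : 0 < h := by positivity
  have hTh : ((n + 1 : ℕ) : ℝ) * h = T := by rw [hh]; push_cast; field_simp
  have hle (k : ℕ) : k * h ≤ (k + 1 : ℕ) * h := by push_cast; linarith
  have hsum := intervalIntegral.sum_integral_adjacent_intervals (μ := volume) (n := n + 1)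
    (f := fun t => integralDeviation (κ t) (u n t) (Ψ t)) (a := fun k : ℕ => k * h)
    fun k _ => by
      rw [intervalIntegrable_iff_integrableOn_Ioc_of_le (hle k)]
      exact integrable_integralDeviation κ (hu n) hΨ.continuous.stronglyMeasurable
        (hΨ.continuous.integrableOn_Icc.mono_set Set.Ioc_subset_Icc_self)
  simp only [Nat.cast_zero, zero_mul, hTh] at hsum
  rw [← hsum, dist_zero_right]
  calc _ ≤ ∑ k ∈ Finset.range (n + 1), 2 * (ε / (4 * T)) * h := by
        refine norm_sum_le_of_le _ fun k _ => ?_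
        have hlen : ((k + 1 : ℕ) : ℝ) * h - k * h = h := by push_cast; ring
        have := norm_integral_integralDeviation_cell_le κ (hu n) (hle k) hΨ.continuous
          (huκ n (Ψ (k * h)) k) (ε := ε / (4 * T)) fun t ht => by
            rw [← dist_eq_norm]
            refine (hΨδ ?_).le
            rw [Real.dist_eq, abs_of_nonneg (by linarith [ht.1])]
            linarith [ht.2]
        rwa [hlen] at this
    _ = 2 * (ε / (4 * T)) * T := by
        rw [Finset.sum_const, Finset.card_range, nsmul_eq_mul]
        linear_combination (2 * (ε / (4 * T))) * hTh
    _ < ε := by field_simp; linarith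

/-- Vanishing of the deviation extends from uniformly continuous to integrable test functions. -/
lemma tendsto_integral_integralDeviation_of_integrable (κ : Kernel ℝ U) [IsMarkovKernel κ]
    {m : Measure ℝ} [m.Regular] {u : ℕ → ℝ → U} (hu : ∀ n, Measurable (u n))
    (hlim : ∀ Ψ : ℝ → C(U, ℝ), UniformContinuous Ψ →
      Tendsto (fun n => ∫ t, integralDeviation (κ t) (u n t) (Ψ t) ∂m) atTop (𝓝 0))
    {Φ : ℝ → C(U, ℝ)} (hΦ : StronglyMeasurable Φ) (hi : Integrable Φ m) :
    Tendsto (fun n => ∫ t, integralDeviation (κ t) (u n t) (Φ t) ∂m) atTop (𝓝 0) := by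
  rw [Metric.tendsto_atTop]
  intro ε hε
  obtain ⟨Ψ, hΨc, hΦΨ, hΨ, hΨi⟩ :=
    hi.exists_hasCompactSupport_integral_sub_le (ε := ε / 4) (by positivity)
  obtain ⟨N, hN⟩ := Metric.tendsto_atTop.1
    (hlim Ψ (hΨc.uniformContinuous_of_continuous hΨ)) (ε / 2) (by positivity)
  refine ⟨N, fun n hn => ?_⟩
  have hn' := hN n hn
  rw [dist_zero_right] at hn' ⊢
  have hdiff : ‖∫ t, integralDeviation (κ t) (u n t) (Φ t - Ψ t) ∂m‖ ≤ 2 * (ε / 4) := by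
    calc _ ≤ ∫ t, 2 * ‖Φ t - Ψ t‖ ∂m :=
          norm_integral_le_of_norm_le ((hi.sub hΨi).norm.const_mul 2)
            (ae_of_all _ fun t => norm_integralDeviation_le _ _ _)
      _ ≤ 2 * (ε / 4) := by rw [integral_const_mul]; gcongr
  simp only [integralDeviation_sub] at hdiff
  rw [integral_sub (integrable_integralDeviation κ (hu n) hΦ hi)
    (integrable_integralDeviation κ (hu n) hΨ.stronglyMeasurable hΨi)] at hdiff
  have := norm_add_le (∫ t, integralDeviation (κ t) (u n t) (Φ t) ∂m -
    ∫ t, integralDeviation (κ t) (u n t) (Ψ t) ∂m)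
    (∫ t, integralDeviation (κ t) (u n t) (Ψ t) ∂m)
  rw [sub_add_cancel] at this
  linarith

end Deviation

/-- Chattering lemma: for a compact separable metric space `U` and a measurable family
`(μ t)_{t ∈ [0,T]}` of probability measures on `U` (measurable for the Borel σ-algebra of the
weak topology on `P(U)`), there is a sequence of measurable `U`-valued functions `u n` such
that `δ_{u n t}(da) dt` converges stably (hence weakly) to `μ t (da) dt` on `[0,T] × U`. -/
theorem chattering_lemma (T : ℝ) (hT : 0 < T) {U : Type*} [MetricSpace U] [CompactSpace U]
    [Nonempty U] [MeasurableSpace U] [BorelSpace U]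
    (μ : ℝ → ProbabilityMeasure U)
    (hμ : @Measurable ℝ (ProbabilityMeasure U) inferInstance (borel (ProbabilityMeasure U)) μ) :
    ∃ u : ℕ → ℝ → U, (∀ n, Measurable (u n)) ∧
      ∀ φ : ℝ × U → ℝ, Measurable φ → (∃ C, ∀ x, |φ x| ≤ C) →
        (∀ t : ℝ, Continuous fun a => φ (t, a)) →
        Tendsto (fun n => ∫ t in Set.Icc 0 T, φ (t, u n t)) atTop
          (nhds (∫ t in Set.Icc 0 T, ∫ a, φ (t, a) ∂(μ t : Measure U))) := by
  let κ : ProbabilityTheory.Kernel ℝ U :=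
    ⟨fun t => (μ t : Measure U), measurable_toMeasure_of_measurable_borel hμ⟩
  have : ProbabilityTheory.IsMarkovKernel κ :=
    ⟨fun t => inferInstanceAs (IsProbabilityMeasure (μ t : Measure U))⟩
  choose u hu huκ using fun n : ℕ =>
    exists_measurable_intervalIntegral_grid_eq κ (h := T / (n + 1)) (by positivity)
  refine ⟨u, hu, fun φ hφ ⟨C, hC⟩ hcont => ?_⟩
  let Φ : ℝ → C(U, ℝ) := fun t => ⟨fun a => φ (t, a), hcont t⟩
  have hΦ : StronglyMeasurable Φ :=
    stronglyMeasurable_continuousMap_of_eval fun a => hφ.comp measurable_prodMk_right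
  have hΦC (t : ℝ) : ‖Φ t‖ ≤ C := (ContinuousMap.norm_le_of_nonempty _).2 fun a => hC (t, a)
  have hΦi : Integrable Φ (volume.restrict (Set.Icc 0 T)) :=
    .of_bound hΦ.aestronglyMeasurable C (ae_of_all _ hΦC)
  have key := tendsto_integral_integralDeviation_of_integrable κ hu (fun Ψ hΨ => by
    simpa only [integral_Icc_eq_integral_Ioc, ← intervalIntegral.integral_of_le hT.le] using
      tendsto_integral_integralDeviation_of_uniformContinuous κ hT hu
        (fun n f => huκ n f f.continuous.measurable ⟨‖f‖, f.norm_coe_le_norm⟩) hΨ) hΦ hΦi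
  have h1 (n : ℕ) : Integrable (fun t => Φ t (u n t)) (volume.restrict (Set.Icc 0 T)) :=
    .of_bound (stronglyMeasurable_eval_continuousMap hΦ (hu n)).aestronglyMeasurable C
      (ae_of_all _ fun t => hC _)
  have h2 : Integrable (fun t => ∫ a, Φ t a ∂(κ t)) (volume.restrict (Set.Icc 0 T)) :=
    .of_bound (stronglyMeasurable_integral_continuousMap κ hΦ).aestronglyMeasurable C
      (ae_of_all _ fun t => by
        simpa using norm_integral_le_of_norm_le_const (μ := κ t) (f := Φ t) (C := C)
          (ae_of_all _ fun a => hC (t, a)))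
  simp only [integralDeviation] at key
  simp_rw [integral_sub (h1 _) h2] at key
  exact tendsto_sub_nhds_zero_iff.1 key
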